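/- arXiv:2211.16364 — 4 statements merged into one kernel-verified Lean document; each statement's English description precedes it below -/
import Mathlib

section
/- Let Q ≥ 1, let τ₁,…,τ_Q be pairwise distinct real numbers and α₁,…,α_Q > 0. Define the moments m_p = Σ_{k=1}^{Q} α_k τ_k^p for p = 0,…,2Q−1, the (Q+1)×Q matrix U by U_{i,j} = m_{i+j−2}, and for 1 ≤ i ≤ Q+1 let D_i be the determinant of the Q×Q matrix obtained by deleting row i from U. Then D_{Q+1} ≠ 0 and every τ_m (1 ≤ m ≤ Q) is a root of the degree-Q polynomial G(x) = Σ_{k=0}^{Q} (−1)^{k+Q} D_{k+1} x^k. -/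
theorem atoms_are_roots_of_hankel_polynomial (Q : ℕ) (hQ : 1 ≤ Q)
    (τ α : Fin Q → ℝ)
    (hτ : Function.Injective τ) (hα : ∀ k, 0 < α k)
    (U : Matrix (Fin (Q + 1)) (Fin Q) ℝ)
    (hU : ∀ (i : Fin (Q + 1)) (j : Fin Q),
      U i j = ∑ k : Fin Q, α k * τ k ^ ((i : ℕ) + (j : ℕ)))
    (D : Fin (Q + 1) → ℝ)
    (hD : ∀ i : Fin (Q + 1), D i = (U.submatrix (Fin.succAbove i) id).det) :
    D (Fin.last Q) ≠ 0 ∧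
      ∀ m : Fin Q,
        ∑ k : Fin (Q + 1), (-1 : ℝ) ^ ((k : ℕ) + Q) * D k * τ m ^ (k : ℕ) = 0 := by
  classical
  set C : ℝ := (∏ k, α k) * (Matrix.vandermonde τ).det with hC
  have key : ∀ i : Fin (Q + 1), D i =
      (Matrix.of fun (a k : Fin Q) => τ k ^ ((i.succAbove a : Fin (Q + 1)) : ℕ)).det * C := by
    intro i
    rw [hD, hC, ← Matrix.det_diagonal, ← Matrix.det_mul, ← Matrix.det_mul]
    congr 1
    ext a j
    rw [Matrix.mul_apply]
    simp only [Matrix.submatrix_apply, id, hU, Matrix.diagonal_mul, Matrix.of_apply,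
      Matrix.vandermonde_apply]
    refine Finset.sum_congr rfl fun k _ => ?_
    rw [pow_add]
    ring
  have hV : (Matrix.vandermonde τ).det ≠ 0 := Matrix.det_vandermonde_ne_zero_iff.mpr hτ
  constructor
  · rw [key]
    refine mul_ne_zero ?_ (mul_ne_zero (Finset.prod_ne_zero_iff.mpr fun k _ => (hα k).ne') hV)
    have : (Matrix.of fun (a k : Fin Q) => τ k ^ (((Fin.last Q).succAbove a : Fin (Q + 1)) : ℕ))
        = (Matrix.vandermonde τ).transpose := by
      ext a k
      simp [Matrix.vandermonde_apply]
    rw [this, Matrix.det_transpose]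
    exact hV
  · intro m
    have h0 : (Matrix.vandermonde (Fin.cons (τ m) τ : Fin (Q + 1) → ℝ)).transpose.det = 0 := by
      rw [Matrix.det_transpose, Matrix.det_vandermonde_eq_zero_iff]
      exact ⟨0, m.succ, by simp, (Fin.succ_ne_zero m).symm⟩
    rw [Matrix.det_succ_column_zero] at h0
    have h1 : ∑ k : Fin (Q + 1), (-1 : ℝ) ^ ((k : ℕ) + Q) * D k * τ m ^ (k : ℕ)
        = ((-1) ^ Q * C) * 0 := by
      rw [← h0, Finset.mul_sum]
      refine Finset.sum_congr rfl fun k _ => ?_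
      have : (Matrix.vandermonde (Fin.cons (τ m) τ : Fin (Q + 1) → ℝ)).transpose.submatrix
          k.succAbove Fin.succ
          = Matrix.of fun (a b : Fin Q) => τ b ^ ((k.succAbove a : Fin (Q + 1)) : ℕ) := by
        ext a b
        rw [Matrix.submatrix_apply, Matrix.transpose_apply, Matrix.vandermonde_apply,
          Fin.cons_succ, Matrix.of_apply]
      rw [this, key, Matrix.transpose_apply, Matrix.vandermonde_apply, Fin.cons_zero, pow_add]
      ring
    rw [h1, mul_zero]
end

section
/- Let Q ≥ 1. Let τ₁,…,τ_Q be pairwise distinct real numbers with positive weights α₁,…,α_Q > 0, and let τ'₁,…,τ'_Q be pairwise distinct real numbers with positive weights α'₁,…,α'_Q > 0. If Σ_{k=1}^{Q} α_k τ_k^p = Σ_{k=1}^{Q} α'_k (τ'_k)^p for every p ∈ {0, 1, …, 2Q−1}, then there exists a permutation σ of {1,…,Q} such that α'_k = α_{σ(k)} and τ'_k = τ_{σ(k)} for all k. -/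
theorem moments_determine_atoms_and_weights (Q : ℕ) (hQ : 1 ≤ Q)
    (τ τ' α α' : Fin Q → ℝ)
    (hτ : Function.Injective τ) (hτ' : Function.Injective τ')
    (hα : ∀ k, 0 < α k) (hα' : ∀ k, 0 < α' k)
    (hmom : ∀ p : ℕ, p < 2 * Q →
      ∑ k : Fin Q, α k * τ k ^ p = ∑ k : Fin Q, α' k * τ' k ^ p) :
    ∃ σ : Equiv.Perm (Fin Q), (∀ k, α' k = α (σ k)) ∧ ∀ k, τ' k = τ (σ k) := by
  classical
  have hpoly : ∀ P : Polynomial ℝ, P.natDegree < 2 * Q →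
      ∑ k, α k * P.eval (τ k) = ∑ k, α' k * P.eval (τ' k) := by
    intro P hP
    have key : ∀ (a t : Fin Q → ℝ), ∑ k, a k * P.eval (t k)
        = ∑ p ∈ Finset.range (2 * Q), P.coeff p * ∑ k, a k * t k ^ p := by
      intro a t
      simp_rw [Polynomial.eval_eq_sum_range' hP, Finset.mul_sum]
      rw [Finset.sum_comm]
      refine Finset.sum_congr rfl fun p _ => Finset.sum_congr rfl fun k _ => by ring
    rw [key, key]
    refine Finset.sum_congr rfl fun p hp => ?_
    rw [hmom p (Finset.mem_range.1 hp)]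
  let S : Finset ℝ := Finset.univ.image τ ∪ Finset.univ.image τ'
  have hS : S.card ≤ 2 * Q := by
    refine (Finset.card_union_le _ _).trans ?_
    have h1 := Finset.card_image_le (s := (Finset.univ : Finset (Fin Q))) (f := τ)
    have h2 := Finset.card_image_le (s := (Finset.univ : Finset (Fin Q))) (f := τ')
    simp only [Finset.card_univ, Fintype.card_fin] at h1 h2
    omega
  have hτS : ∀ k, τ k ∈ S := fun k => by simp [S]
  have hτS' : ∀ k, τ' k ∈ S := fun k => by simp [S]
  have hw : ∀ x ∈ S, ∑ k, (if τ k = x then α k else 0) = ∑ k, (if τ' k = x then α' k else 0) := by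
    intro x hx
    let P : Polynomial ℝ := ∏ y ∈ S.erase x, (Polynomial.X - Polynomial.C y)
    have hdeg : P.natDegree < 2 * Q := by
      have h1 : P.natDegree = (S.erase x).card := by
        simp only [P]
        rw [Polynomial.natDegree_prod_of_monic _ _ fun y _ => Polynomial.monic_X_sub_C y]
        simp
      have h2 := Finset.card_erase_lt_of_mem hx
      omega
    have hPx : P.eval x ≠ 0 := by
      simp only [P, Polynomial.eval_prod, Polynomial.eval_sub, Polynomial.eval_X, Polynomial.eval_C]
      refine Finset.prod_ne_zero_iff.2 fun y hy => sub_ne_zero.2 (Finset.ne_of_mem_erase hy).symm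
    have hP0 : ∀ y ∈ S, y ≠ x → P.eval y = 0 := by
      intro y hy hyx
      simp only [P, Polynomial.eval_prod, Polynomial.eval_sub, Polynomial.eval_X, Polynomial.eval_C]
      exact Finset.prod_eq_zero (Finset.mem_erase.2 ⟨hyx, hy⟩) (sub_self y)
    have key : ∀ (a t : Fin Q → ℝ), (∀ k, t k ∈ S) →
        ∑ k, a k * P.eval (t k) = (∑ k, (if t k = x then a k else 0)) * P.eval x := by
      intro a t ht
      rw [Finset.sum_mul]
      refine Finset.sum_congr rfl fun k _ => ?_
      split_ifs with h
      · rw [h]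
      · rw [hP0 _ (ht k) h]; simp
    have h := hpoly P hdeg
    rw [key _ _ hτS, key _ _ hτS'] at h
    exact mul_right_cancel₀ hPx h
  have hself : ∀ (a t : Fin Q → ℝ), Function.Injective t → ∀ j,
      ∑ k, (if t k = t j then a k else 0) = a j := by
    intro a t ht j
    simp [ht.eq_iff]
  have hex : ∀ k, ∃ j, τ' k = τ j := by
    intro k
    by_contra! hne
    have h := hw _ (hτS' k)
    rw [hself _ _ hτ', Finset.sum_eq_zero fun j _ => if_neg (hne j).symm] at h
    exact (hα' k).ne h
  choose s hs using hex
  have hinj : Function.Injective s := fun a b hab => hτ' (by rw [hs, hs, hab])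
  refine ⟨Equiv.ofBijective s (Finite.injective_iff_bijective.1 hinj), fun k => ?_, fun k => hs k⟩
  have h := hw _ (hτS' k)
  rw [hself _ _ hτ', hs k, hself _ _ hτ] at h
  exact h.symm
end

section
/- In the CoOP-LBM, under the parameter constraints A1–A4 the model is identifiable. Precisely: let n₁, n₂, Q₁, Q₂ ≥ 1 with n₁ ≥ 2Q₂ − 1 and n₂ ≥ 2Q₁ − 1. For parameters θ = (α, β, π, λ, μ, G), define the likelihood function f(·; θ) : ℕ^{n₁×n₂} → ℝ by f(r; θ) = Σ_{z¹ : {1,…,n₁}→{1,…,Q₁}} Σ_{z² : {1,…,n₂}→{1,…,Q₂}} [∏_{i=1}^{n₁} α_{z¹(i)}] [∏_{j=1}^{n₂} β_{z²(j)}] [∏_{(i,j): r_{ij}>0} π_{z¹(i),z²(j)} (λ_i μ_j G)^{r_{ij}} e^{−λ_i μ_j G} / r_{ij}!] [∏_{(i,j): r_{ij}=0} (1 − π_{z¹(i),z²(j)}(1 − e^{−λ_i μ_j G}))]. Suppose θ and θ' both satisfy: (A1) all α_k > 0 and the coordinates of τ = πβ (τ_k = Σ_l π_{kl} β_l) are pairwise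 distinct; (A2) all β_l > 0 and the coordinates of σ = αᵀπ (σ_l = Σ_k α_k π_{kl}) are pairwise distinct; (A4) G > 0, λ_i ∈ (0,1] with max_i λ_i = 1, μ_j ∈ (0,1] with max_j μ_j = 1; and α, β are probability vectors and π_{kl} ∈ (0,1). If f(r; θ) = f(r; θ') for every r ∈ ℕ^{n₁×n₂}, then λ = λ', μ = μ', G = G', and there exist permutations s of {1,…,Q₁} and t of {1,…,Q₂} such that α'_k = α_{s(k)}, β'_l = β_{t(l)}, and π'_{k,l} = π_{s(k),t(l)} for all k, l. -/
/-- The likelihood (probability mass function) of an observed count matrix `r`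
under the CoOP-LBM with parameters `(α, β, πm, lam, mu, G)`. -/
noncomputable def coopLBMLikelihood (n₁ n₂ Q₁ Q₂ : ℕ)
    (α : Fin Q₁ → ℝ) (β : Fin Q₂ → ℝ) (πm : Fin Q₁ → Fin Q₂ → ℝ)
    (lam : Fin n₁ → ℝ) (mu : Fin n₂ → ℝ) (G : ℝ)
    (r : Fin n₁ → Fin n₂ → ℕ) : ℝ :=
  ∑ z₁ : Fin n₁ → Fin Q₁, ∑ z₂ : Fin n₂ → Fin Q₂,
    (∏ i, α (z₁ i)) * (∏ j, β (z₂ j)) *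
      ∏ i, ∏ j,
        if 0 < r i j then
          πm (z₁ i) (z₂ j) * (lam i * mu j * G) ^ (r i j) *
            Real.exp (-(lam i * mu j * G)) / (r i j).factorial
        else
          1 - πm (z₁ i) (z₂ j) * (1 - Real.exp (-(lam i * mu j * G)))

open Finset Polynomial in
theorem aux_moments {Q : ℕ} (α α' τ τ' : Fin Q → ℝ) (hα' : ∀ k, 0 < α' k)
    (hτ : Function.Injective τ) (hτ' : Function.Injective τ')
    (h : ∀ m < 2 * Q, ∑ k, α k * τ k ^ m = ∑ k, α' k * τ' k ^ m) :
    ∃ s : Equiv.Perm (Fin Q), (∀ k, α' k = α (s k)) ∧ ∀ k, τ' k = τ (s k) := by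
  have hP : ∀ P : ℝ[X], P.natDegree < 2 * Q →
      ∑ k, α k * P.eval (τ k) = ∑ k, α' k * P.eval (τ' k) := by
    intro P hP
    simp only [Polynomial.eval_eq_sum_range' hP, Finset.mul_sum]
    rw [Finset.sum_comm]
    conv_rhs => rw [Finset.sum_comm]
    refine Finset.sum_congr rfl fun m hm => ?_
    have := h m (Finset.mem_range.1 hm)
    calc _ = P.coeff m * ∑ k, α k * τ k ^ m := by
            rw [Finset.mul_sum]; exact Finset.sum_congr rfl fun _ _ => by ring
      _ = _ := by
            rw [this, Finset.mul_sum]; exact Finset.sum_congr rfl fun _ _ => by ring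
  have hdeg : ∀ (S : Finset (Fin Q)) (v : Fin Q → ℝ),
      (∏ j ∈ S, (X - C (v j))).natDegree = S.card := by
    intro S v
    exact Polynomial.natDegree_finsetProd_X_sub_C_eq_card S v
  have hex : ∀ k, ∃ k', τ' k = τ k' := by
    intro k
    by_contra! hne
    have hQ : 0 < Q := k.pos
    have h1 := hP ((∏ j ∈ univ.erase k, (X - C (τ' j))) * ∏ j ∈ univ, (X - C (τ j))) (by
      refine lt_of_le_of_lt Polynomial.natDegree_mul_le ?_
      rw [hdeg, hdeg, Finset.card_erase_of_mem (mem_univ _)]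
      simp; omega)
    simp only [eval_mul, eval_prod, eval_sub, eval_X, eval_C] at h1
    rw [Finset.sum_eq_zero, Finset.sum_eq_single k] at h1
    · have h2 : α' k * ((∏ j ∈ univ.erase k, (τ' k - τ' j)) * ∏ j, (τ' k - τ j)) ≠ 0 := by
        refine mul_ne_zero (hα' k).ne' (mul_ne_zero ?_ ?_)
        · refine Finset.prod_ne_zero_iff.2 fun j hj => sub_ne_zero.2 fun e => ?_
          exact (Finset.ne_of_mem_erase hj) (hτ' e).symm
        · exact Finset.prod_ne_zero_iff.2 fun j hj => sub_ne_zero.2 (hne j)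
      exact h2 h1.symm
    · intro b _ hb
      rw [Finset.prod_eq_zero (i := b) (Finset.mem_erase.2 ⟨hb, mem_univ _⟩) (sub_self _)]
      ring
    · simp
    · intro b _
      rw [Finset.prod_eq_zero (s := univ) (i := b) (mem_univ _) (sub_self (τ b))]
      ring
  choose s hs using hex
  have hinj : Function.Injective s := fun a b hab => hτ' (by rw [hs, hs b, hab])
  let e : Equiv.Perm (Fin Q) := Equiv.ofBijective s (Finite.injective_iff_bijective.1 hinj)
  refine ⟨e, fun k => ?_, hs⟩
  change α' k = α (s k)
  have hQ : 0 < Q := k.pos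
  have h1 := hP (∏ j ∈ univ.erase k, (X - C (τ' j))) (by
      rw [hdeg, Finset.card_erase_of_mem (mem_univ _)]
      simp; omega)
  simp only [eval_prod, eval_sub, eval_X, eval_C] at h1
  rw [← Equiv.sum_comp e] at h1
  have h3 : ∀ i, τ (e i) = τ' i := fun i => (hs i).symm
  simp only [h3] at h1
  have hz : ∀ c : Fin Q → ℝ, ∑ i, c i * ∏ j ∈ univ.erase k, (τ' i - τ' j)
      = c k * ∏ j ∈ univ.erase k, (τ' k - τ' j) := by
    intro c
    refine Finset.sum_eq_single k (fun b _ hb => ?_) (by simp)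
    rw [Finset.prod_eq_zero (i := b) (Finset.mem_erase.2 ⟨hb, mem_univ _⟩) (sub_self _)]
    ring
  rw [hz (fun i => α (e i)), hz α'] at h1
  refine (mul_right_cancel₀ ?_ h1).symm
  refine Finset.prod_ne_zero_iff.2 fun j hj => sub_ne_zero.2 fun e => ?_
  exact (Finset.ne_of_mem_erase hj) (hτ' e).symm

theorem aux_vand {Q₁ Q₂ : ℕ} (τ : Fin Q₁ → ℝ) (σ : Fin Q₂ → ℝ)
    (hτ : Function.Injective τ) (hσ : Function.Injective σ) (w : Fin Q₁ → Fin Q₂ → ℝ)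
    (h : ∀ a < Q₁, ∀ b < Q₂, ∑ k, ∑ l, w k l * τ k ^ a * σ l ^ b = 0) :
    ∀ k l, w k l = 0 := by
  have h1 : ∀ b < Q₂, ∀ k, ∑ l, w k l * σ l ^ b = 0 := by
    intro b hb
    have := Matrix.eq_zero_of_forall_pow_sum_mul_pow_eq_zero (f := τ)
      (v := fun k => ∑ l, w k l * σ l ^ b) hτ (fun a => by
        rw [← h a a.2 b hb]
        refine Finset.sum_congr rfl fun k _ => ?_
        rw [Finset.sum_mul]
        exact Finset.sum_congr rfl fun l _ => by ring)
    exact fun k => congrFun this k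
  intro k
  have := Matrix.eq_zero_of_forall_pow_sum_mul_pow_eq_zero (f := σ)
      (v := fun l => w k l) hσ (fun b => h1 b b.2 k)
  exact fun l => congrFun this l

theorem aux_expand {P Ω Ω' : Type*} [Fintype P] [DecidableEq P] [Fintype Ω] [Fintype Ω']
    (w : Ω → ℝ) (v : Ω → P → ℝ) (w' : Ω' → ℝ) (v' : Ω' → P → ℝ) (p : P → ℝ)
    (h : ∀ T : Finset P, ∑ ω, w ω * ∏ q, (if q ∈ T then v ω q else 1 - v ω q * p q) =
      ∑ ω, w' ω * ∏ q, (if q ∈ T then v' ω q else 1 - v' ω q * p q)) (S : Finset P) :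
    ∑ ω, w ω * ∏ q, (if q ∈ S then v ω q else 1) =
      ∑ ω, w' ω * ∏ q, (if q ∈ S then v' ω q else 1) := by
  have key : ∀ u : P → ℝ, ∏ q, (if q ∈ S then u q else 1) =
      ∑ T : Finset P, (∏ q, (if q ∈ T then (if q ∈ S then 1 else p q) else
        (if q ∈ S then 0 else 1))) * ∏ q, (if q ∈ T then u q else 1 - u q * p q) := by
    intro u
    have : ∀ q, (if q ∈ S then u q else 1) = (if q ∈ S then 1 else p q) * u q +
        (if q ∈ S then 0 else 1) * (1 - u q * p q) := by
      intro q; split_ifs <;> ring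
    simp only [this]
    rw [Finset.prod_add]
    simp only [Finset.powerset_univ]
    refine Finset.sum_congr rfl fun T _ => ?_
    rw [← Finset.prod_mul_distrib]
    rw [← Finset.prod_mul_prod_compl T (fun q => (if q ∈ T then (if q ∈ S then 1 else p q) else
        (if q ∈ S then 0 else 1)) * (if q ∈ T then u q else 1 - u q * p q))]
    congr 1
    · exact Finset.prod_congr rfl fun q hq => by simp only [if_pos hq]
    · rw [← Finset.compl_eq_univ_sdiff]
      exact Finset.prod_congr rfl fun q hq => by simp only [if_neg (Finset.mem_compl.1 hq)]
  simp only [key, Finset.mul_sum]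
  rw [Finset.sum_comm]
  conv_rhs => rw [Finset.sum_comm]
  refine Finset.sum_congr rfl fun T _ => ?_
  simp only [mul_left_comm (w _), mul_left_comm (w' _)]
  rw [← Finset.mul_sum, ← Finset.mul_sum, h T]

theorem aux_sum_prod {m Q : ℕ} (f : Fin m → Fin Q → ℝ) :
    ∑ z : Fin m → Fin Q, ∏ i, f i (z i) = ∏ i, ∑ k, f i k := by
  rw [Finset.prod_univ_sum, Fintype.piFinset_univ]

theorem aux_sum_cons {m Q : ℕ} (F : (Fin (m+1) → Fin Q) → ℝ) :
    ∑ z, F z = ∑ a, ∑ z : Fin m → Fin Q, F (Fin.cons a z) := by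
  rw [← Fintype.sum_prod_type']
  exact (Equiv.sum_comp (Fin.consEquiv (fun _ : Fin (m+1) => Fin Q)) F).symm

theorem aux_star {m₁ m₂ Q₁ Q₂ : ℕ} (α : Fin Q₁ → ℝ) (β : Fin Q₂ → ℝ)
    (h : Fin (m₁+1) → Fin (m₂+1) → Fin Q₁ → Fin Q₂ → ℝ)
    (h1 : ∀ (i : Fin m₁) (j : Fin m₂) k l, h i.succ j.succ k l = 1) :
    ∑ z₁ : Fin (m₁+1) → Fin Q₁, ∑ z₂ : Fin (m₂+1) → Fin Q₂,
      (∏ i, α (z₁ i)) * (∏ j, β (z₂ j)) * ∏ i, ∏ j, h i j (z₁ i) (z₂ j) =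
    ∑ a, ∑ b, α a * β b * h 0 0 a b * (∏ j : Fin m₂, ∑ l, β l * h 0 j.succ a l) *
      ∏ i : Fin m₁, ∑ k, α k * h i.succ 0 k b := by
  rw [aux_sum_cons]
  refine Finset.sum_congr rfl fun a _ => ?_
  simp only [aux_sum_cons (m := m₂)]
  rw [Finset.sum_comm]
  refine Finset.sum_congr rfl fun b _ => ?_
  simp only [Fin.prod_univ_succ, Fin.cons_zero, Fin.cons_succ, h1, Finset.prod_const_one, mul_one]
  rw [← aux_sum_prod (fun j l => β l * h 0 (Fin.succ j) a l),
    ← aux_sum_prod (fun i k => α k * h (Fin.succ i) 0 k b)]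
  rw [mul_assoc, Finset.sum_mul_sum, Finset.mul_sum, Finset.sum_comm]
  refine Finset.sum_congr rfl fun z₂ _ => ?_
  rw [Finset.mul_sum]
  refine Finset.sum_congr rfl fun z₁ _ => ?_
  simp only [Finset.prod_mul_distrib]
  ring

theorem aux_prod_lt {m c : ℕ} (hc : c ≤ m) (x : ℝ) :
    ∏ j : Fin m, (if (j : ℕ) < c then x else 1) = x ^ c := by
  rw [Finset.prod_ite, Finset.prod_const_one, mul_one, Finset.prod_const]
  congr 1
  simp [Fin.card_filter_val_lt, hc]

/-- star moments -/
theorem aux_star_moment {m₁ m₂ Q₁ Q₂ : ℕ} (α : Fin Q₁ → ℝ) (β : Fin Q₂ → ℝ)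
    (πm : Fin Q₁ → Fin Q₂ → ℝ) (hα : ∑ k, α k = 1) (hβ : ∑ l, β l = 1)
    (c d : ℕ) (hc : c ≤ m₂) (hd : d ≤ m₁) (S : Finset (Fin (m₁+1) × Fin (m₂+1)))
    (hS : ∀ i j, (i, j) ∈ S ↔ (i = 0 ∧ (j : ℕ) < c + 1) ∨ (j = 0 ∧ (i : ℕ) < d + 1)) :
    ∑ z₁ : Fin (m₁+1) → Fin Q₁, ∑ z₂ : Fin (m₂+1) → Fin Q₂,
      (∏ i, α (z₁ i)) * (∏ j, β (z₂ j)) *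
        ∏ i, ∏ j, (if (i, j) ∈ S then πm (z₁ i) (z₂ j) else 1) =
    ∑ a, ∑ b, α a * β b * πm a b * (∑ l, πm a l * β l) ^ c * (∑ k, α k * πm k b) ^ d := by
  rw [aux_star α β (fun i j k l => if (i, j) ∈ S then πm k l else 1)]
  · refine Finset.sum_congr rfl fun a _ => Finset.sum_congr rfl fun b _ => ?_
    rw [← aux_prod_lt hc, ← aux_prod_lt hd]
    congr 1
    · congr 1
      · simp [hS]
      · refine Finset.prod_congr rfl fun j _ => ?_
        by_cases h : (j : ℕ) < c
        · simp [hS, h, mul_comm]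
        · simp [hS, h, hβ]
    · refine Finset.prod_congr rfl fun j _ => ?_
      by_cases h : (j : ℕ) < d
      · simp [hS, h]
      · simp [hS, h, hα]
  · intro i j k l
    simp [hS]

/-- likelihood factorization when `r = 1_T`. -/
theorem aux_lik_ind (n₁ n₂ Q₁ Q₂ : ℕ)
    (α : Fin Q₁ → ℝ) (β : Fin Q₂ → ℝ) (πm : Fin Q₁ → Fin Q₂ → ℝ)
    (lam : Fin n₁ → ℝ) (mu : Fin n₂ → ℝ) (G : ℝ) (T : Finset (Fin n₁ × Fin n₂)) :
    coopLBMLikelihood n₁ n₂ Q₁ Q₂ α β πm lam mu G (fun i j => if (i, j) ∈ T then 1 else 0) =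
    (∏ i, ∏ j, if (i, j) ∈ T then lam i * mu j * G * Real.exp (-(lam i * mu j * G)) else 1) *
    ∑ ω : (Fin n₁ → Fin Q₁) × (Fin n₂ → Fin Q₂),
      ((∏ i, α (ω.1 i)) * (∏ j, β (ω.2 j))) *
      ∏ q : Fin n₁ × Fin n₂, (if q ∈ T then πm (ω.1 q.1) (ω.2 q.2) else
        1 - πm (ω.1 q.1) (ω.2 q.2) * (1 - Real.exp (-(lam q.1 * mu q.2 * G)))) := by
  unfold coopLBMLikelihood
  rw [Fintype.sum_prod_type, Finset.mul_sum]
  refine Finset.sum_congr rfl fun z₁ _ => ?_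
  rw [Finset.mul_sum]
  refine Finset.sum_congr rfl fun z₂ _ => ?_
  rw [mul_left_comm]
  congr 1
  rw [Fintype.prod_prod_type, ← Finset.prod_mul_distrib]
  refine Finset.prod_congr rfl fun i _ => ?_
  rw [← Finset.prod_mul_distrib]
  refine Finset.prod_congr rfl fun j _ => ?_
  by_cases h : (i, j) ∈ T
  · simp [h]; ring
  · simp [h]

theorem aux_lik_pos (n₁ n₂ Q₁ Q₂ : ℕ)
    (α : Fin Q₁ → ℝ) (β : Fin Q₂ → ℝ) (πm : Fin Q₁ → Fin Q₂ → ℝ)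
    (lam : Fin n₁ → ℝ) (mu : Fin n₂ → ℝ) (G : ℝ) (r : Fin n₁ → Fin n₂ → ℕ)
    (hr : ∀ i j, 0 < r i j) :
    coopLBMLikelihood n₁ n₂ Q₁ Q₂ α β πm lam mu G r =
    (∏ q : Fin n₁ × Fin n₂, (lam q.1 * mu q.2 * G) ^ (r q.1 q.2) *
        Real.exp (-(lam q.1 * mu q.2 * G)) / (r q.1 q.2).factorial) *
    ∑ z₁ : Fin n₁ → Fin Q₁, ∑ z₂ : Fin n₂ → Fin Q₂,
      ((∏ i, α (z₁ i)) * (∏ j, β (z₂ j))) * ∏ i, ∏ j, πm (z₁ i) (z₂ j) := by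
  unfold coopLBMLikelihood
  rw [Finset.mul_sum]
  refine Finset.sum_congr rfl fun z₁ _ => ?_
  rw [Finset.mul_sum]
  refine Finset.sum_congr rfl fun z₂ _ => ?_
  rw [mul_left_comm]
  congr 1
  rw [Fintype.prod_prod_type, ← Finset.prod_mul_distrib]
  refine Finset.prod_congr rfl fun i _ => ?_
  rw [← Finset.prod_mul_distrib]
  refine Finset.prod_congr rfl fun j _ => ?_
  rw [if_pos (hr i j)]
  ring

theorem aux_lik_ratio (n₁ n₂ Q₁ Q₂ : ℕ)
    (α : Fin Q₁ → ℝ) (β : Fin Q₂ → ℝ) (πm : Fin Q₁ → Fin Q₂ → ℝ)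
    (lam : Fin n₁ → ℝ) (mu : Fin n₂ → ℝ) (G : ℝ) (q₀ : Fin n₁ × Fin n₂) :
    coopLBMLikelihood n₁ n₂ Q₁ Q₂ α β πm lam mu G (fun i j => if (i, j) = q₀ then 2 else 1) =
    (lam q₀.1 * mu q₀.2 * G) / 2 *
      coopLBMLikelihood n₁ n₂ Q₁ Q₂ α β πm lam mu G (fun _ _ => 1) := by
  rw [aux_lik_pos _ _ _ _ _ _ _ _ _ _ _ (fun i j => by split_ifs <;> norm_num),
    aux_lik_pos _ _ _ _ _ _ _ _ _ _ _ (fun i j => one_pos), ← mul_assoc]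
  congr 1
  rw [← Finset.mul_prod_erase _ _ (Finset.mem_univ q₀)]
  conv_rhs => rw [← Finset.mul_prod_erase _ _ (Finset.mem_univ q₀)]
  rw [← mul_assoc]
  congr 1
  · simp; ring
  · refine Finset.prod_congr rfl fun q hq => ?_
    simp [Finset.ne_of_mem_erase hq]

theorem aux_lik_one_pos (n₁ n₂ Q₁ Q₂ : ℕ) (hQ₁ : 1 ≤ Q₁) (hQ₂ : 1 ≤ Q₂)
    (α : Fin Q₁ → ℝ) (β : Fin Q₂ → ℝ) (πm : Fin Q₁ → Fin Q₂ → ℝ)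
    (lam : Fin n₁ → ℝ) (mu : Fin n₂ → ℝ) (G : ℝ)
    (hα : ∀ k, 0 < α k) (hβ : ∀ k, 0 < β k) (hπ : ∀ k l, 0 < πm k l)
    (hlam : ∀ k, 0 < lam k) (hmu : ∀ k, 0 < mu k) (hG : 0 < G) :
    0 < coopLBMLikelihood n₁ n₂ Q₁ Q₂ α β πm lam mu G (fun _ _ => 1) := by
  rw [aux_lik_pos _ _ _ _ _ _ _ _ _ _ _ (fun i j => one_pos)]
  haveI : Nonempty (Fin Q₁) := ⟨⟨0, hQ₁⟩⟩
  haveI : Nonempty (Fin Q₂) := ⟨⟨0, hQ₂⟩⟩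
  refine mul_pos (Finset.prod_pos fun q _ => ?_) ?_
  · have := hlam q.1
    have := hmu q.2
    positivity
  · refine Finset.sum_pos (fun z₁ _ => Finset.sum_pos (fun z₂ _ => ?_) Finset.univ_nonempty)
      Finset.univ_nonempty
    exact mul_pos (mul_pos (Finset.prod_pos fun _ _ => hα _) (Finset.prod_pos fun _ _ => hβ _))
      (Finset.prod_pos fun _ _ => Finset.prod_pos fun _ _ => hπ _ _)

theorem aux_G_le {n₁ n₂ : ℕ} {lam lam' : Fin n₁ → ℝ} {mu mu' : Fin n₂ → ℝ} {G G' : ℝ}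
    (hG' : 0 < G') (hlam' : ∀ i, lam' i ∈ Set.Ioc (0 : ℝ) 1)
    (hlam_max : ∃ i, lam i = 1) (hmu' : ∀ j, mu' j ∈ Set.Ioc (0 : ℝ) 1)
    (hmu_max : ∃ j, mu j = 1) (hx : ∀ i j, lam i * mu j * G = lam' i * mu' j * G') : G ≤ G' := by
  obtain ⟨i, hi⟩ := hlam_max
  obtain ⟨j, hj⟩ := hmu_max
  have := hx i j
  rw [hi, hj] at this
  have h1 : lam' i * mu' j ≤ 1 := mul_le_one₀ (hlam' i).2 (hmu' j).1.le (hmu' j).2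
  nlinarith

theorem aux_mom_row {Q₁ Q₂ : ℕ} (α : Fin Q₁ → ℝ) (β : Fin Q₂ → ℝ) (πm : Fin Q₁ → Fin Q₂ → ℝ)
    (c : ℕ) :
    ∑ a, ∑ b, α a * β b * πm a b * (∑ l, πm a l * β l) ^ c * (∑ k, α k * πm k b) ^ 0 =
    ∑ a, α a * (∑ l, πm a l * β l) ^ (c+1) := by
  refine Finset.sum_congr rfl fun a _ => ?_
  rw [pow_succ', Finset.sum_mul, Finset.mul_sum]
  exact Finset.sum_congr rfl fun b _ => by ring

theorem aux_mom_col {Q₁ Q₂ : ℕ} (α : Fin Q₁ → ℝ) (β : Fin Q₂ → ℝ) (πm : Fin Q₁ → Fin Q₂ → ℝ)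
    (c : ℕ) :
    ∑ a, ∑ b, α a * β b * πm a b * (∑ l, πm a l * β l) ^ 0 * (∑ k, α k * πm k b) ^ c =
    ∑ b, β b * (∑ k, α k * πm k b) ^ (c+1) := by
  rw [Finset.sum_comm]
  refine Finset.sum_congr rfl fun a _ => ?_
  rw [pow_succ', Finset.sum_mul, Finset.mul_sum]
  exact Finset.sum_congr rfl fun b _ => by ring

theorem coopLBM_identifiability
    (n₁ n₂ Q₁ Q₂ : ℕ) (hQ₁ : 1 ≤ Q₁) (hQ₂ : 1 ≤ Q₂)
    (hn₁ : 2 * Q₂ - 1 ≤ n₁) (hn₂ : 2 * Q₁ - 1 ≤ n₂)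
    (hn₁' : 1 ≤ n₁) (hn₂' : 1 ≤ n₂)
    (α α' : Fin Q₁ → ℝ) (β β' : Fin Q₂ → ℝ)
    (πm πm' : Fin Q₁ → Fin Q₂ → ℝ)
    (lam lam' : Fin n₁ → ℝ) (mu mu' : Fin n₂ → ℝ) (G G' : ℝ)
    -- probability vectors and connection probabilities in (0,1)
    (hαsum : ∑ k, α k = 1) (hα'sum : ∑ k, α' k = 1)
    (hβsum : ∑ l, β l = 1) (hβ'sum : ∑ l, β' l = 1)
    (hπ : ∀ k l, πm k l ∈ Set.Ioo (0 : ℝ) 1) (hπ' : ∀ k l, πm' k l ∈ Set.Ioo (0 : ℝ) 1)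
    -- (A1)
    (hα : ∀ k, 0 < α k) (hα' : ∀ k, 0 < α' k)
    (hτ : Function.Injective fun k : Fin Q₁ => ∑ l, πm k l * β l)
    (hτ' : Function.Injective fun k : Fin Q₁ => ∑ l, πm' k l * β' l)
    -- (A2)
    (hβ : ∀ l, 0 < β l) (hβ' : ∀ l, 0 < β' l)
    (hσ : Function.Injective fun l : Fin Q₂ => ∑ k, α k * πm k l)
    (hσ' : Function.Injective fun l : Fin Q₂ => ∑ k, α' k * πm' k l)
    -- (A4)
    (hG : 0 < G) (hG' : 0 < G')
    (hlam : ∀ i, lam i ∈ Set.Ioc (0 : ℝ) 1) (hlam' : ∀ i, lam' i ∈ Set.Ioc (0 : ℝ) 1)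
    (hlam_max : ∃ i, lam i = 1) (hlam'_max : ∃ i, lam' i = 1)
    (hmu : ∀ j, mu j ∈ Set.Ioc (0 : ℝ) 1) (hmu' : ∀ j, mu' j ∈ Set.Ioc (0 : ℝ) 1)
    (hmu_max : ∃ j, mu j = 1) (hmu'_max : ∃ j, mu' j = 1)
    -- equality of likelihoods
    (heq : ∀ r : Fin n₁ → Fin n₂ → ℕ,
      coopLBMLikelihood n₁ n₂ Q₁ Q₂ α β πm lam mu G r =
        coopLBMLikelihood n₁ n₂ Q₁ Q₂ α' β' πm' lam' mu' G' r) :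
    lam = lam' ∧ mu = mu' ∧ G = G' ∧
      ∃ (s : Equiv.Perm (Fin Q₁)) (t : Equiv.Perm (Fin Q₂)),
        (∀ k, α' k = α (s k)) ∧ (∀ l, β' l = β (t l)) ∧
          ∀ k l, πm' k l = πm (s k) (t l) := by
  have hx : ∀ i j, lam i * mu j * G = lam' i * mu' j * G' := by
    intro i j
    have h1 := heq (fun a b => if (a, b) = (i, j) then 2 else 1)
    rw [aux_lik_ratio, aux_lik_ratio, heq (fun _ _ => 1)] at h1
    have h2 := aux_lik_one_pos n₁ n₂ Q₁ Q₂ hQ₁ hQ₂ α' β' πm' lam' mu' G' hα' hβ'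
      (fun k l => (hπ' k l).1) (fun k => (hlam' k).1) (fun k => (hmu' k).1) hG'
    have h3 := mul_right_cancel₀ h2.ne' h1
    simp only at h3
    linarith
  have hGG : G = G' := le_antisymm (aux_G_le hG' hlam' hlam_max hmu' hmu_max hx)
    (aux_G_le hG hlam hlam'_max hmu hmu'_max fun i j => (hx i j).symm)
  subst hGG
  have hx2 : ∀ i j, lam i * mu j = lam' i * mu' j := fun i j =>
    mul_right_cancel₀ hG.ne' (hx i j)
  obtain ⟨i₀, hi₀⟩ := hlam_max
  obtain ⟨j₀, hj₀⟩ := hmu_max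
  have h00 := hx2 i₀ j₀
  rw [hi₀, hj₀, one_mul] at h00
  have hi₀' : lam' i₀ = 1 := by
    have := hlam' i₀; have := hmu' j₀
    simp only [Set.mem_Ioc] at *
    nlinarith
  have hj₀' : mu' j₀ = 1 := by rw [hi₀', one_mul] at h00; exact h00.symm
  have hlamE : lam = lam' := by
    funext i; have := hx2 i j₀; rwa [hj₀, hj₀', mul_one, mul_one] at this
  have hmuE : mu = mu' := by
    funext j; have := hx2 i₀ j; rwa [hi₀, hi₀', one_mul, one_mul] at this
  subst hlamE
  subst hmuE
  refine ⟨rfl, rfl, rfl, ?_⟩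
  obtain ⟨m₁, rfl⟩ : ∃ m, n₁ = m + 1 := ⟨n₁ - 1, by omega⟩
  obtain ⟨m₂, rfl⟩ : ∃ m, n₂ = m + 1 := ⟨n₂ - 1, by omega⟩
  have hexp := aux_expand
    (fun ω : (Fin (m₁+1) → Fin Q₁) × (Fin (m₂+1) → Fin Q₂) =>
      (∏ i, α (ω.1 i)) * (∏ j, β (ω.2 j)))
    (fun ω (q : Fin (m₁+1) × Fin (m₂+1)) => πm (ω.1 q.1) (ω.2 q.2))
    (fun ω : (Fin (m₁+1) → Fin Q₁) × (Fin (m₂+1) → Fin Q₂) =>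
      (∏ i, α' (ω.1 i)) * (∏ j, β' (ω.2 j)))
    (fun ω (q : Fin (m₁+1) × Fin (m₂+1)) => πm' (ω.1 q.1) (ω.2 q.2))
    (fun q : Fin (m₁+1) × Fin (m₂+1) => 1 - Real.exp (-(lam q.1 * mu q.2 * G))) (by
      intro T
      have h1 := heq (fun i j => if (i, j) ∈ T then 1 else 0)
      rw [aux_lik_ind, aux_lik_ind] at h1
      refine mul_left_cancel₀ (ne_of_gt ?_) h1
      refine Finset.prod_pos fun i _ => Finset.prod_pos fun j _ => ?_
      have := (hlam i).1
      have := (hmu j).1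
      split_ifs <;> positivity)
  have hmom : ∀ c ≤ m₂, ∀ d ≤ m₁,
      ∑ a, ∑ b, α a * β b * πm a b * (∑ l, πm a l * β l) ^ c * (∑ k, α k * πm k b) ^ d =
      ∑ a, ∑ b, α' a * β' b * πm' a b * (∑ l, πm' a l * β' l) ^ c *
        (∑ k, α' k * πm' k b) ^ d := by
    intro c hc d hd
    let S : Finset (Fin (m₁+1) × Fin (m₂+1)) := Finset.univ.filter fun q =>
      (q.1 = 0 ∧ (q.2 : ℕ) < c + 1) ∨ (q.2 = 0 ∧ (q.1 : ℕ) < d + 1)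
    have hS : ∀ i j, (i, j) ∈ S ↔ (i = 0 ∧ (j : ℕ) < c + 1) ∨ (j = 0 ∧ (i : ℕ) < d + 1) := by
      intro i j; simp [S]
    rw [← aux_star_moment α β πm hαsum hβsum c d hc hd S hS,
      ← aux_star_moment α' β' πm' hα'sum hβ'sum c d hc hd S hS]
    have := hexp S
    simpa only [Fintype.sum_prod_type, Fintype.prod_prod_type] using this
  obtain ⟨s, hsα, hsτ⟩ := aux_moments α α' _ _ hα' hτ hτ' (by
    intro m hm
    rcases m with _ | c
    · simp [hαsum, hα'sum]
    · have := hmom c (by omega) 0 (by omega)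
      rwa [aux_mom_row, aux_mom_row] at this)
  obtain ⟨t, htβ, htσ⟩ := aux_moments β β' _ _ hβ' hσ hσ' (by
    intro m hm
    rcases m with _ | c
    · simp [hβsum, hβ'sum]
    · have := hmom 0 (by omega) c (by omega)
      rwa [aux_mom_col, aux_mom_col] at this)
  refine ⟨s, t, hsα, htβ, ?_⟩
  have hw := aux_vand _ _ hτ' hσ'
    (fun k l => α' k * β' l * πm' k l - α' k * β' l * πm (s k) (t l)) (by
      intro a ha b hb
      have h1 := hmom a (by omega) b (by omega)
      rw [← Equiv.sum_comp s] at h1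
      simp only [sub_mul, Finset.sum_sub_distrib]
      rw [← h1, sub_eq_zero]
      refine Finset.sum_congr rfl fun k _ => ?_
      rw [← Equiv.sum_comp t]
      refine Finset.sum_congr rfl fun l _ => ?_
      have e1 := hsτ k
      have e2 := htσ l
      rw [e1, e2, hsα, htβ])
  intro k l
  have h1 := hw k l
  exact mul_left_cancel₀ (mul_pos (hα' k) (hβ' l)).ne' (sub_eq_zero.1 h1)
end

section
/- For the CoOP-LBM likelihood f(·; θ) with parameters θ = (α, β, π, λ, μ, G) where α and β are probability vectors with positive entries, π_{kl} ∈ [0,1], λ_i, μ_j ∈ (0,1], G > 0, and for any 1 ≤ p ≤ n₂, the probability that the first p entries of the first row are all positive equals u_p := Σ_{r ∈ ℕ^{n₁×n₂} : r_{1,1}>0,…,r_{1,p}>0} f(r; θ) = [∏_{j=1}^{p} (1 − e^{−λ₁ μ_j G})] · Σ_{k=1}^{Q₁} α_k τ_k^p, where τ_k = Σ_{l=1}^{Q₂} π_{kl} β_l. -/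
theorem aux_hasSum_pi {κ : Type} : ∀ (n : ℕ) (f : Fin n → κ → ℝ) (s : Fin n → ℝ)
    (_ : ∀ i x, 0 ≤ f i x) (_ : ∀ i, HasSum (f i) (s i)),
    HasSum (fun r : Fin n → κ => ∏ i, f i (r i)) (∏ i, s i) := by
  intro n
  induction n with
  | zero =>
    intro f s _ _
    simp
  | succ n ih =>
    intro f s h0 hs
    have h1 := ih (fun i => f i.succ) (fun i => s i.succ) (fun i x => h0 _ x) (fun i => hs _)
    have hsm := (hs 0).summable.mul_of_nonneg h1.summable (fun x => h0 0 x)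
      (fun r => Finset.prod_nonneg fun i _ => h0 _ _)
    have h2 := (hs 0).mul h1 hsm
    rw [Fin.prod_univ_succ, ← (Fin.consEquiv (fun _ : Fin (n+1) => κ)).hasSum_iff]
    convert! h2 using 1
    funext x
    simp [Fin.prod_univ_succ, Fin.consEquiv]

theorem aux_cell_pos (x q : ℝ) :
    HasSum (fun n : ℕ => if 0 < n then q * x ^ n * Real.exp (-x) / n.factorial else 0)
      (q * (1 - Real.exp (-x))) := by
  have h : HasSum (fun n : ℕ => x ^ n / n.factorial) (Real.exp x) := by
    rw [Real.exp_eq_exp_ℝ]; exact NormedSpace.expSeries_div_hasSum_exp x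
  have h2 := (h.mul_left (q * Real.exp (-x))).update 0 0
  convert! h2 using 1
  · funext n
    rcases Nat.eq_zero_or_pos n with rfl | hn
    · simp
    · simp [hn, hn.ne', Function.update]; ring
  · rw [mul_assoc q _ (Real.exp x), ← Real.exp_add]; simp; ring

theorem aux_cell (x q : ℝ) :
    HasSum (fun n : ℕ => if 0 < n then q * x ^ n * Real.exp (-x) / n.factorial else
      1 - q * (1 - Real.exp (-x))) 1 := by
  have h2 := (aux_cell_pos x q).update 0 (1 - q * (1 - Real.exp (-x)))
  convert! h2 using 1
  · funext n
    rcases Nat.eq_zero_or_pos n with rfl | hn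
    · simp
    · simp [hn, hn.ne', Function.update]
  · simp

theorem coopLBM_first_row_positive_prob
    (n₁ n₂ Q₁ Q₂ : ℕ) (hQ₁ : 1 ≤ Q₁) (hQ₂ : 1 ≤ Q₂) (hn₁ : 1 ≤ n₁)
    (α : Fin Q₁ → ℝ) (β : Fin Q₂ → ℝ) (πm : Fin Q₁ → Fin Q₂ → ℝ)
    (lam : Fin n₁ → ℝ) (mu : Fin n₂ → ℝ) (G : ℝ)
    (hαsum : ∑ k, α k = 1) (hβsum : ∑ l, β l = 1)
    (hα : ∀ k, 0 < α k) (hβ : ∀ l, 0 < β l)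
    (hπ : ∀ k l, πm k l ∈ Set.Icc (0 : ℝ) 1)
    (hlam : ∀ i, lam i ∈ Set.Ioc (0 : ℝ) 1) (hmu : ∀ j, mu j ∈ Set.Ioc (0 : ℝ) 1)
    (hG : 0 < G)
    (p : ℕ) (hp1 : 1 ≤ p) (hp : p ≤ n₂) :
    ∑' r : {r : Fin n₁ → Fin n₂ → ℕ // ∀ j : Fin p, 0 < r ⟨0, hn₁⟩ (Fin.castLE hp j)},
        coopLBMLikelihood n₁ n₂ Q₁ Q₂ α β πm lam mu G r.1
      = (∏ j : Fin p, (1 - Real.exp (-(lam ⟨0, hn₁⟩ * mu (Fin.castLE hp j) * G)))) *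
          ∑ k : Fin Q₁, α k * (∑ l, πm k l * β l) ^ p := by
  classical
  set i0 : Fin n₁ := ⟨0, hn₁⟩ with hi0
  -- cell functions
  let x : Fin n₁ → Fin n₂ → ℝ := fun i j => lam i * mu j * G
  have hx : ∀ i j, 0 ≤ x i j := fun i j =>
    mul_nonneg (mul_nonneg (hlam i).1.le (hmu j).1.le) hG.le
  have he : ∀ i j, 0 ≤ 1 - Real.exp (-(x i j)) ∧ 1 - Real.exp (-(x i j)) ≤ 1 := fun i j =>
    ⟨by have := Real.exp_le_one_iff.2 (neg_nonpos.2 (hx i j)); linarith,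
     by have := Real.exp_pos (-(x i j)); linarith⟩
  let g : ℝ → Fin n₁ → Fin n₂ → ℕ → ℝ := fun q i j n =>
    if 0 < n then q * (x i j) ^ n * Real.exp (-(x i j)) / n.factorial else
      if i = i0 ∧ (j : ℕ) < p then 0 else 1 - q * (1 - Real.exp (-(x i j)))
  let c : ℝ → Fin n₁ → Fin n₂ → ℝ := fun q i j =>
    if i = i0 ∧ (j : ℕ) < p then q * (1 - Real.exp (-(x i j))) else 1
  have hg0 : ∀ q ∈ Set.Icc (0:ℝ) 1, ∀ i j n, 0 ≤ g q i j n := by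
    intro q hq i j n
    have h1 := hx i j
    have h2 := he i j
    have h3 := hq.1
    have h4 : q * (1 - Real.exp (-(x i j))) ≤ 1 := mul_le_one₀ hq.2 h2.1 h2.2
    simp only [g]
    split_ifs
    · positivity
    · exact le_rfl
    · linarith
  have hgs : ∀ q i j, HasSum (g q i j) (c q i j) := by
    intro q i j
    by_cases h : i = i0 ∧ (j : ℕ) < p
    · simp only [g, c, if_pos h]; exact aux_cell_pos _ _
    · simp only [g, c, if_neg h]; exact aux_cell _ _
  have hS : HasSum (fun r : Fin n₁ → Fin n₂ → ℕ =>
      ∑ z₁ : Fin n₁ → Fin Q₁, ∑ z₂ : Fin n₂ → Fin Q₂,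
        (∏ i, α (z₁ i)) * (∏ j, β (z₂ j)) * ∏ i, ∏ j, g (πm (z₁ i) (z₂ j)) i j (r i j))
      (∑ z₁ : Fin n₁ → Fin Q₁, ∑ z₂ : Fin n₂ → Fin Q₂,
        (∏ i, α (z₁ i)) * (∏ j, β (z₂ j)) * ∏ i, ∏ j, c (πm (z₁ i) (z₂ j)) i j) := by
    refine hasSum_sum fun z₁ _ => hasSum_sum fun z₂ _ => HasSum.mul_left _ ?_
    refine aux_hasSum_pi n₁ (fun i (y : Fin n₂ → ℕ) => ∏ j, g (πm (z₁ i) (z₂ j)) i j (y j)) _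
      (fun i y => Finset.prod_nonneg fun j _ => hg0 _ (hπ _ _) _ _ _) (fun i => ?_)
    exact aux_hasSum_pi n₂ (fun j => g (πm (z₁ i) (z₂ j)) i j) _
      (fun j n => hg0 _ (hπ _ _) _ _ _) (fun j => hgs _ _ _)
  have hind : HasSum (fun r : {r : Fin n₁ → Fin n₂ → ℕ //
        ∀ j : Fin p, 0 < r i0 (Fin.castLE hp j)} =>
        coopLBMLikelihood n₁ n₂ Q₁ Q₂ α β πm lam mu G r.1)
      (∑ z₁ : Fin n₁ → Fin Q₁, ∑ z₂ : Fin n₂ → Fin Q₂,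
        (∏ i, α (z₁ i)) * (∏ j, β (z₂ j)) * ∏ i, ∏ j, c (πm (z₁ i) (z₂ j)) i j) := by
    have key := hasSum_subtype_iff_indicator
      (f := coopLBMLikelihood n₁ n₂ Q₁ Q₂ α β πm lam mu G)
      (s := {r : Fin n₁ → Fin n₂ → ℕ | ∀ j : Fin p, 0 < r i0 (Fin.castLE hp j)})
      (a := ∑ z₁ : Fin n₁ → Fin Q₁, ∑ z₂ : Fin n₂ → Fin Q₂,
        (∏ i, α (z₁ i)) * (∏ j, β (z₂ j)) * ∏ i, ∏ j, c (πm (z₁ i) (z₂ j)) i j)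
    refine key.2 ?_
    convert hS using 1
    funext r
    by_cases hr : ∀ j : Fin p, 0 < r i0 (Fin.castLE hp j)
    · rw [Set.indicator_of_mem (by exact hr)]
      unfold coopLBMLikelihood
      refine Finset.sum_congr rfl fun z₁ _ => Finset.sum_congr rfl fun z₂ _ => ?_
      congr 1
      refine Finset.prod_congr rfl fun i _ => Finset.prod_congr rfl fun j _ => ?_
      simp only [g, x]
      by_cases h : 0 < r i j
      · simp only [if_pos h]
      · have : ¬ (i = i0 ∧ (j : ℕ) < p) := by
          rintro ⟨h1, h2⟩
          subst h1
          exact h (hr ⟨j, h2⟩)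
        simp only [if_neg h, if_neg this]
    · rw [Set.indicator_of_notMem (by exact hr)]
      symm
      push Not at hr
      obtain ⟨j, hj⟩ := hr
      refine Finset.sum_eq_zero fun z₁ _ => Finset.sum_eq_zero fun z₂ _ => ?_
      refine mul_eq_zero_of_right _ ?_
      refine Finset.prod_eq_zero (Finset.mem_univ i0) ?_
      refine Finset.prod_eq_zero (Finset.mem_univ (Fin.castLE hp j)) ?_
      have : ¬ 0 < r i0 (Fin.castLE hp j) := by omega
      simp only [g, if_neg this]
      rw [if_pos]
      simp
  rw [hind.tsum_eq]
  let d : Fin Q₁ → Fin n₂ → ℝ := fun k j =>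
    if (j : ℕ) < p then (1 - Real.exp (-(x i0 j))) * ∑ l, πm k l * β l else 1
  have hz2 : ∀ z₁ : Fin n₁ → Fin Q₁, ∑ z₂ : Fin n₂ → Fin Q₂,
        (∏ i, α (z₁ i)) * (∏ j, β (z₂ j)) * ∏ i, ∏ j, c (πm (z₁ i) (z₂ j)) i j
      = (∏ i, α (z₁ i)) * ∏ j, d (z₁ i0) j := by
    intro z₁
    have h1 : ∀ z₂ : Fin n₂ → Fin Q₂, ∏ i, ∏ j, c (πm (z₁ i) (z₂ j)) i j
        = ∏ j, c (πm (z₁ i0) (z₂ j)) i0 j := by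
      intro z₂
      refine Finset.prod_eq_single i0 (fun i _ hi => ?_) (by simp)
      exact Finset.prod_eq_one fun j _ => by simp [c, hi]
    simp only [h1, mul_assoc, ← Finset.mul_sum, ← Finset.prod_mul_distrib]
    congr 1
    rw [← Fintype.piFinset_univ,
      ← Finset.prod_univ_sum (fun _ => Finset.univ) (fun j l => β l * c (πm (z₁ i0) l) i0 j)]
    refine Finset.prod_congr rfl fun j _ => ?_
    simp only [c, d]
    by_cases h : (j : ℕ) < p
    · simp only [h, and_self, if_true, Finset.mul_sum]
      exact Finset.sum_congr rfl fun l _ => by ring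
    · simp [h, hβsum]
  simp only [hz2]
  have hz1 : ∀ z₁ : Fin n₁ → Fin Q₁, (∏ i, α (z₁ i)) * ∏ j, d (z₁ i0) j
      = ∏ i, (α (z₁ i) * if i = i0 then ∏ j, d (z₁ i) j else 1) := by
    intro z₁
    rw [Finset.prod_mul_distrib]
    simp
  simp only [hz1]
  rw [← Fintype.piFinset_univ,
      ← Finset.prod_univ_sum (fun _ => Finset.univ)
        (fun i k => α k * if i = i0 then ∏ j, d k j else 1),
    Finset.prod_eq_single i0 (fun i _ hi => by simp [hi, hαsum]) (by simp), Finset.mul_sum]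
  refine Finset.sum_congr rfl fun k _ => ?_
  have hd : ∏ j, d k j = ∏ j : Fin p, ((1 - Real.exp (-(x i0 (Fin.castLE hp j)))) *
      ∑ l, πm k l * β l) := by
    symm
    refine Fintype.prod_of_injective (Fin.castLE hp) (Fin.castLE_injective hp) _ _
      (fun j hj => ?_) (fun j => ?_)
    · simp only [d]
      rw [if_neg]
      intro h
      exact hj ⟨⟨j, h⟩, rfl⟩
    · simp [d]
  rw [if_pos rfl, hd, Finset.prod_mul_distrib]
  simp only [Finset.prod_const, Finset.card_univ, Fintype.card_fin, x]
  ring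
end
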